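/- arXiv:2403.01475 — 4 statements merged into one kernel-verified Lean document; each statement's English description precedes it below -/
import Mathlib

section
/- For every α ∈ [0,1] and γ ∈ (0,1], the matrices L^{(α,γ)} and L^{(1/2,γ)} are similar via the similarity identity L^{(α,γ)} = M_γ^{1/2-α} L^{(1/2,γ)} M_γ^{α-1/2}; in particular, L^{(α,γ)} and L^{(1/2,γ)} have the same characteristic polynomial and hence the same eigenvalues with multiplicity. -/
open Matrix

/-- For every `α ∈ [0,1]` and `γ ∈ (0,1]`, `L^{(α,γ)}` and `L^{(1/2,γ)}` are
similar via `L^{(α,γ)} = M_γ^{1/2-α} L^{(1/2,γ)} M_γ^{α-1/2}`; in particular they have the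
same characteristic polynomial, hence the same eigenvalues with multiplicity. -/
theorem stmt_8 (N : ℕ) (hN : 1 ≤ N)
    (A : Matrix (Fin N) (Fin N) ℝ)
    (hAsym : A.IsSymm)
    (hA01 : ∀ i j, A i j = 0 ∨ A i j = 1)
    (hAdiag : ∀ i, A i i = 0)
    (d : Fin N → ℝ) (hd : ∀ i, d i = ∑ j, A i j)
    (D : Matrix (Fin N) (Fin N) ℝ) (hD : D = Matrix.diagonal d)
    (L : Matrix (Fin N) (Fin N) ℝ) (hL : L = D - A)
    (γ : ℝ) (hγ : γ ∈ Set.Ioc (0 : ℝ) 1)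
    (α : ℝ) (hα : α ∈ Set.Icc (0 : ℝ) 1)
    (hpos : ∀ i, 0 < γ * d i + (1 - γ))
    (Mpow : ℝ → Matrix (Fin N) (Fin N) ℝ)
    (hMpow : ∀ β : ℝ, Mpow β = Matrix.diagonal (fun i => (γ * d i + (1 - γ)) ^ β)) :
    γ • (Mpow (-α) * L * Mpow (α - 1))
      = Mpow (1/2 - α) * (γ • (Mpow (-(1/2 : ℝ)) * L * Mpow (-(1/2 : ℝ)))) * Mpow (α - 1/2) ∧
    (γ • (Mpow (-α) * L * Mpow (α - 1))).charpoly
      = (γ • (Mpow (-(1/2 : ℝ)) * L * Mpow (-(1/2 : ℝ)))).charpoly := by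
  have hmul : ∀ a b : ℝ, Mpow a * Mpow b = Mpow (a + b) := by
    intro a b
    simp only [hMpow, diagonal_mul_diagonal]
    congr 1
    funext i
    exact (Real.rpow_add (hpos i) a b).symm
  have hzero : Mpow 0 = 1 := by simp [hMpow]
  have hsim : γ • (Mpow (-α) * L * Mpow (α - 1))
      = Mpow (1/2 - α) * (γ • (Mpow (-(1/2 : ℝ)) * L * Mpow (-(1/2 : ℝ)))) * Mpow (α - 1/2) := by
    have hleft : Mpow (-α) = Mpow (1/2 - α) * Mpow (-(1/2 : ℝ)) := by
      rw [hmul]; congr 1; ring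
    have hright : Mpow (α - 1) = Mpow (-(1/2 : ℝ)) * Mpow (α - 1/2) := by
      rw [hmul]; congr 1; ring
    rw [hleft, hright]
    simp only [mul_smul_comm, smul_mul_assoc, Matrix.mul_assoc]
  refine ⟨hsim, ?_⟩
  have hinv : Mpow (α - 1/2) * Mpow (1/2 - α) = 1 := by
    rw [hmul, ← hzero]; congr 1; ring
  rw [hsim, charpoly_mul_comm, ← Matrix.mul_assoc, hinv, Matrix.one_mul]
end

section
/- Suppose G is connected with N ≥ 2 vertices. For 0 < γ₁ < γ₂ ≤ 1, let λ^{(0)}(γ) ≤ λ^{(1)}(γ) ≤ … ≤ λ^{(N-1)}(γ) denote the eigenvalues of the symmetric matrix L^{(1/2,γ)} listed in nondecreasing order with multiplicity. Then λ^{(0)}(γ₁) = λ^{(0)}(γ₂) = 0, and for every i with 1 ≤ i ≤ N-1, λ^{(i)}(γ₁) < λ^{(i)}(γ₂); that is, each nonzero-indexed eigenvalue is strictly increasing in γ. -/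
open Matrix Polynomial

/-- A real symmetric matrix is orthogonally diagonalized by any monotone listing of the roots of
its characteristic polynomial. -/
lemma Matrix.IsHermitian.exists_orthogonal_diagonalization {N : ℕ}
    {S : Matrix (Fin N) (Fin N) ℝ} (hS : S.IsHermitian) {μ : Fin N → ℝ} (hμ : Monotone μ)
    (hchar : S.charpoly = ∏ i, (X - C (μ i))) :
    ∃ U : Matrix (Fin N) (Fin N) ℝ, Uᵀ * U = 1 ∧ S = Uᵀ * diagonal μ * U := by
  set σ := Tuple.sort hS.eigenvalues with hσ
  have hroots : Multiset.map μ Finset.univ.val =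
      Multiset.map (hS.eigenvalues ∘ σ) Finset.univ.val := by
    have h := hS.roots_charpoly_eq_eigenvalues
    rw [hchar, roots_prod _ _ (by simp [Finset.prod_ne_zero_iff, X_sub_C_ne_zero])] at h
    rw [← Multiset.map_map, Multiset.map_univ_val_equiv]
    simpa using h
  have hμσ : μ = hS.eigenvalues ∘ σ := by
    rw [Fin.univ_val_map, Fin.univ_val_map, Multiset.coe_eq_coe] at hroots
    exact List.ofFn_injective (hroots.eq_of_sortedLE hμ.sortedLE_ofFn
      (Tuple.monotone_sort hS.eigenvalues).sortedLE_ofFn)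
  have hU : (hS.eigenvectorUnitary : Matrix (Fin N) (Fin N) ℝ) *
      (hS.eigenvectorUnitary : Matrix (Fin N) (Fin N) ℝ)ᵀ = 1 := by
    simpa [star_eq_conjTranspose] using Unitary.coe_mul_star_self hS.eigenvectorUnitary
  have hspec := hS.spectral_theorem
  rw [Unitary.conjStarAlgAut_apply] at hspec
  refine ⟨(hS.eigenvectorUnitary : Matrix (Fin N) (Fin N) ℝ)ᵀ.submatrix σ id, ?_, ?_⟩
  · rw [transpose_submatrix, transpose_transpose, submatrix_mul_equiv, hU, submatrix_id_id]
  · rw [hμσ, ← submatrix_diagonal_equiv, transpose_submatrix, transpose_transpose,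
      submatrix_mul_equiv, submatrix_mul_equiv, submatrix_id_id]
    conv_lhs => rw [hspec]
    simp [star_eq_conjTranspose]

/-- If `μ` lists the eigenvalues of `W A W`, where `W` is diagonal with entries `w`, then the
quadratic forms of `A` and of `W⁻²` are diagonalized simultaneously, with coefficients `μ`
and `1`. -/
lemma exists_simultaneous_diagonalization {N : ℕ} {A : Matrix (Fin N) (Fin N) ℝ}
    (hA : A.IsSymm) {w p : Fin N → ℝ} (hwp : ∀ i, w i ^ 2 * p i = 1)
    {μ : Fin N → ℝ} (hμ : Monotone μ)
    (hchar : (diagonal w * A * diagonal w).charpoly = ∏ i, (X - C (μ i))) :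
    ∃ Y : Matrix (Fin N) (Fin N) ℝ, ∀ x : Fin N → ℝ,
      x ⬝ᵥ A *ᵥ x = ∑ j, μ j * (Y *ᵥ x) j ^ 2 ∧
      ∑ j, p j * x j ^ 2 = ∑ j, (Y *ᵥ x) j ^ 2 := by
  have hw : ∀ i, w i ≠ 0 := fun i h => by simpa [h] using hwp i
  have hS : (diagonal w * A * diagonal w).IsHermitian := by
    rw [IsHermitian, conjTranspose_eq_transpose_of_trivial, transpose_mul, transpose_mul,
      diagonal_transpose, hA.eq, Matrix.mul_assoc]
  obtain ⟨U, hU, hSU⟩ := hS.exists_orthogonal_diagonalization hμ hchar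
  have hinv : diagonal w * diagonal w⁻¹ = 1 := by
    rw [diagonal_mul_diagonal, ← diagonal_one]
    congr 1; ext i; simp [hw i]
  have hinv' : diagonal w⁻¹ * diagonal w = 1 := by
    rw [diagonal_mul_diagonal, ← diagonal_one]
    congr 1; ext i; simp [hw i]
  have hquad (M : Matrix (Fin N) (Fin N) ℝ) (ν x : Fin N → ℝ) :
      x ⬝ᵥ (Mᵀ * diagonal ν * M) *ᵥ x = ∑ j, ν j * (M *ᵥ x) j ^ 2 := by
    rw [← mulVec_mulVec, ← mulVec_mulVec, dotProduct_mulVec, vecMul_transpose]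
    simp only [dotProduct, mulVec_diagonal]
    exact Finset.sum_congr rfl fun j _ => by ring
  refine ⟨U * diagonal w⁻¹, fun x => ⟨?_, ?_⟩⟩
  · rw [← hquad]
    congr 2
    calc A = (diagonal w⁻¹ * diagonal w) * A * (diagonal w * diagonal w⁻¹) := by
          rw [hinv, hinv', Matrix.one_mul, Matrix.mul_one]
      _ = diagonal w⁻¹ * (diagonal w * A * diagonal w) * diagonal w⁻¹ := by
          simp only [Matrix.mul_assoc]
      _ = _ := by
          rw [hSU, transpose_mul, diagonal_transpose]
          simp only [Matrix.mul_assoc]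
  · have h := hquad (U * diagonal w⁻¹) 1 x
    simp only [Pi.one_apply, one_mul] at h
    rw [← h]
    have hgram : (U * diagonal w⁻¹)ᵀ * diagonal 1 * (U * diagonal w⁻¹) = diagonal p := by
      calc _ = diagonal w⁻¹ * (Uᵀ * U) * diagonal w⁻¹ := by
            rw [show diagonal (1 : Fin N → ℝ) = 1 from diagonal_one, transpose_mul,
              diagonal_transpose]
            simp only [Matrix.mul_assoc, Matrix.one_mul]
        _ = diagonal p := by
            rw [hU, Matrix.mul_one, diagonal_mul_diagonal]
            congr 1; ext i
            have := hwp i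
            have := hw i
            simp only [Pi.inv_apply]
            field_simp
            linarith
    rw [hgram]
    simp only [dotProduct, mulVec_diagonal]
    exact Finset.sum_congr rfl fun j _ => by ring

lemma exists_ne_zero_mulVec_eq_zero {n : Type*} [Fintype n] [DecidableEq n] (R : n → n → ℝ)
    (i : n) : ∃ x : n → ℝ, x ≠ 0 ∧ ∀ j, j ≠ i → R j ⬝ᵥ x = 0 := by
  obtain ⟨x, hx, h⟩ := exists_mulVec_eq_zero_iff.mpr
    (det_eq_zero_of_row_eq_zero (A := of fun j => if j = i then 0 else R j) i (by simp))
  refine ⟨x, hx, fun j hj => ?_⟩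
  simpa [mulVec, hj] using congrFun h j

/-- A Courant–Fischer comparison: for two forms `Q x = ∑ μ j (Y x)ⱼ²` and `∑ ν j (Z x)ⱼ²` with
nondecreasing coefficients, some nonzero `x` sees the first bounded below by `μ i` and the second
bounded above by `ν i`. -/
lemma exists_ne_zero_courant_fischer {N : ℕ} (Y Z : Matrix (Fin N) (Fin N) ℝ)
    {μ ν : Fin N → ℝ} (hμ : Monotone μ) (hν : Monotone ν) (i : Fin N) :
    ∃ x : Fin N → ℝ, x ≠ 0 ∧
      μ i * ∑ j, (Y *ᵥ x) j ^ 2 ≤ ∑ j, μ j * (Y *ᵥ x) j ^ 2 ∧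
      ∑ j, ν j * (Z *ᵥ x) j ^ 2 ≤ ν i * ∑ j, (Z *ᵥ x) j ^ 2 := by
  obtain ⟨x, hx, h⟩ := exists_ne_zero_mulVec_eq_zero (fun j => if j < i then Y j else Z j) i
  refine ⟨x, hx, ?_, ?_⟩ <;> rw [Finset.mul_sum] <;> refine Finset.sum_le_sum fun j _ => ?_
  · rcases lt_or_ge j i with hj | hj
    · have : (Y *ᵥ x) j = 0 := by simpa [mulVec, hj] using h j hj.ne
      simp [this]
    · exact mul_le_mul_of_nonneg_right (hμ hj) (sq_nonneg _)
  · rcases le_or_gt j i with hj | hj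
    · exact mul_le_mul_of_nonneg_right (hν hj) (sq_nonneg _)
    · have : (Z *ᵥ x) j = 0 := by simpa [mulVec, hj.not_gt] using h j hj.ne'
      simp [this]

lemma sum_mul_sq_pos {n : Type*} [Fintype n] {p x : n → ℝ} (hp : ∀ i, 0 < p i) (hx : x ≠ 0) :
    0 < ∑ j, p j * x j ^ 2 := by
  obtain ⟨i, hi⟩ := Function.ne_iff.mp hx
  exact Finset.sum_pos' (fun j _ => mul_nonneg (hp j).le (sq_nonneg _))
    ⟨i, Finset.mem_univ i, mul_pos (hp i) (sq_pos_of_ne_zero (by simpa using hi))⟩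

section Weighted

variable {N : ℕ} {A : Matrix (Fin N) (Fin N) ℝ}

lemma eigenvalue_zero_eq_zero (hN : 0 < N) (hpsd : ∀ x, 0 ≤ x ⬝ᵥ A *ᵥ x)
    (hone : (1 : Fin N → ℝ) ⬝ᵥ A *ᵥ 1 = 0) {p μ : Fin N → ℝ} (hp : ∀ i, 0 < p i)
    (hμ : Monotone μ) {Y : Matrix (Fin N) (Fin N) ℝ}
    (hY : ∀ x : Fin N → ℝ, x ⬝ᵥ A *ᵥ x = ∑ j, μ j * (Y *ᵥ x) j ^ 2 ∧
      ∑ j, p j * x j ^ 2 = ∑ j, (Y *ᵥ x) j ^ 2) :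
    μ ⟨0, hN⟩ = 0 := by
  apply le_antisymm
  · have hpos : 0 < ∑ j, (Y *ᵥ 1) j ^ 2 := by
      rw [← (hY 1).2]
      refine sum_mul_sq_pos hp fun h => ?_
      simpa using congrFun h ⟨0, hN⟩
    have hle : μ ⟨0, hN⟩ * ∑ j, (Y *ᵥ 1) j ^ 2 ≤ 0 := by
      rw [← hone, (hY 1).1, Finset.mul_sum]
      exact Finset.sum_le_sum fun j _ =>
        mul_le_mul_of_nonneg_right (hμ (Fin.mk_le_of_le_val (Nat.zero_le _))) (sq_nonneg _)
    exact nonpos_of_mul_nonpos_left hle hpos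
  · obtain ⟨x, hx, -, h⟩ := exists_ne_zero_courant_fischer Y Y hμ hμ ⟨0, hN⟩
    rw [← (hY x).1, ← (hY x).2] at h
    exact nonneg_of_mul_nonneg_left ((hpsd x).trans h) (sum_mul_sq_pos hp hx)

lemma eigenvalue_pos (hker : ∀ x : Fin N → ℝ, x ⬝ᵥ A *ᵥ x ≤ 0 → ∀ i j, x i = x j)
    {μ : Fin N → ℝ} (hμ : Monotone μ) {Y : Matrix (Fin N) (Fin N) ℝ}
    (hY : ∀ x : Fin N → ℝ, x ⬝ᵥ A *ᵥ x = ∑ j, μ j * (Y *ᵥ x) j ^ 2) {i : Fin N}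
    (hi : (i : ℕ) ≠ 0) : 0 < μ i := by
  by_contra! hle
  have hN : 0 < N := i.pos
  have hi0 : i ≠ ⟨0, hN⟩ := fun h => hi (by simp [h])
  obtain ⟨x, hx, h⟩ := exists_ne_zero_mulVec_eq_zero
    (fun j => if j = i then Pi.single ⟨0, hN⟩ 1 else if i < j then Y j else 0) ⟨0, hN⟩
  have hx0 : x ⟨0, hN⟩ = 0 := by simpa using h i hi0
  have hconst := hker x <| by
    rw [hY x]
    refine Finset.sum_nonpos fun j _ => ?_
    rcases le_or_gt j i with hj | hj
    · exact mul_nonpos_of_nonpos_of_nonneg ((hμ hj).trans hle) (sq_nonneg _)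
    · have hj0 : j ≠ ⟨0, hN⟩ := fun h0 => by simp [h0, Fin.lt_def] at hj
      have : (Y *ᵥ x) j = 0 := by simpa [mulVec, hj, hj.ne'] using h j hj0
      simp [this]
  exact hx (funext fun j => (hconst j _).trans hx0)

lemma eigenvalue_lt_of_weight_lt {p q μ ν : Fin N → ℝ} (hq : ∀ i, 0 < q i)
    (hpq : ∀ i, q i < p i) (hμ : Monotone μ) (hν : Monotone ν)
    {Y Z : Matrix (Fin N) (Fin N) ℝ}
    (hY : ∀ x : Fin N → ℝ, x ⬝ᵥ A *ᵥ x = ∑ j, μ j * (Y *ᵥ x) j ^ 2 ∧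
      ∑ j, p j * x j ^ 2 = ∑ j, (Y *ᵥ x) j ^ 2)
    (hZ : ∀ x : Fin N → ℝ, x ⬝ᵥ A *ᵥ x = ∑ j, ν j * (Z *ᵥ x) j ^ 2 ∧
      ∑ j, q j * x j ^ 2 = ∑ j, (Z *ᵥ x) j ^ 2)
    {i : Fin N} (hi : 0 < μ i) : μ i < ν i := by
  obtain ⟨x, hx, h₁, h₂⟩ := exists_ne_zero_courant_fischer Y Z hμ hν i
  rw [← (hY x).1, ← (hY x).2] at h₁
  rw [← (hZ x).1, ← (hZ x).2] at h₂
  have hqx := sum_mul_sq_pos hq hx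
  have hdiff : 0 < ∑ j, (p j - q j) * x j ^ 2 :=
    sum_mul_sq_pos (fun j => sub_pos.mpr (hpq j)) hx
  simp only [sub_mul, Finset.sum_sub_distrib] at hdiff
  refine lt_of_mul_lt_mul_right ?_ hqx.le
  calc μ i * ∑ j, q j * x j ^ 2 < μ i * ∑ j, p j * x j ^ 2 :=
          mul_lt_mul_of_pos_left (by linarith) hi
    _ ≤ ν i * ∑ j, q j * x j ^ 2 := h₁.trans h₂

end Weighted

lemma smul_diagonal_rpow_conj {n : Type*} [Fintype n] [DecidableEq n] (L : Matrix n n ℝ)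
    {γ : ℝ} (hγ : 0 ≤ γ) (m : n → ℝ) (β : ℝ) :
    γ • (diagonal (fun i => m i ^ β) * L * diagonal (fun i => m i ^ β)) =
      diagonal (fun i => √γ * m i ^ β) * L * diagonal (fun i => √γ * m i ^ β) := by
  ext i j
  simp only [Matrix.smul_apply, diagonal_mul, mul_diagonal, smul_eq_mul]
  linear_combination (-(m i ^ β * L i j * m j ^ β)) * Real.mul_self_sqrt hγ

lemma sqrt_mul_rpow_sq_mul {γ δ : ℝ} (hγ : 0 < γ) (hγ' : γ ≤ 1) (hδ : 0 < δ) :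
    (√γ * (γ * δ + (1 - γ)) ^ (-(1/2 : ℝ))) ^ 2 * (δ + γ⁻¹ - 1) = 1 := by
  have hm : 0 < γ * δ + (1 - γ) := by nlinarith [mul_pos hγ hδ]
  have hr : ((γ * δ + (1 - γ)) ^ (-(1/2 : ℝ))) ^ 2 = (γ * δ + (1 - γ))⁻¹ := by
    rw [← Real.rpow_natCast, ← Real.rpow_mul hm.le, ← Real.rpow_neg_one]
    norm_num
  rw [mul_pow, Real.sq_sqrt hγ.le, hr]
  field_simp
  ring

/-- Suppose `G` is connected with `N ≥ 2` vertices. For `0 < γ₁ < γ₂ ≤ 1`,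
let `μ₁` (resp. `μ₂`) be the eigenvalues of the symmetric matrix `L^{(1/2,γ₁)}` (resp.
`L^{(1/2,γ₂)}`), listed in nondecreasing order with multiplicity (encoded by monotonicity
together with the factorization of the characteristic polynomial). Then
`μ₁(0) = μ₂(0) = 0`, and for every `1 ≤ i ≤ N-1`, `μ₁(i) < μ₂(i)`. -/
theorem stmt_10 (N : ℕ) (hN : 2 ≤ N)
    (G : SimpleGraph (Fin N)) [DecidableRel G.Adj] (hGconn : G.Connected)
    (A : Matrix (Fin N) (Fin N) ℝ) (hA : A = G.adjMatrix ℝ)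
    (d : Fin N → ℝ) (hd : ∀ i, d i = ∑ j, A i j)
    (D : Matrix (Fin N) (Fin N) ℝ) (hD : D = Matrix.diagonal d)
    (L : Matrix (Fin N) (Fin N) ℝ) (hL : L = D - A)
    (γ₁ γ₂ : ℝ) (hγ₁ : 0 < γ₁) (hγ₁₂ : γ₁ < γ₂) (hγ₂ : γ₂ ≤ 1)
    (Mpow : ℝ → ℝ → Matrix (Fin N) (Fin N) ℝ)
    (hMpow : ∀ (γ β : ℝ),
      Mpow γ β = Matrix.diagonal (fun i => (γ * d i + (1 - γ)) ^ β))
    (μ₁ μ₂ : Fin N → ℝ) (hμ₁mono : Monotone μ₁) (hμ₂mono : Monotone μ₂)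
    (hchar₁ : (γ₁ • (Mpow γ₁ (-(1/2 : ℝ)) * L * Mpow γ₁ (-(1/2 : ℝ)))).charpoly
      = ∏ i, (X - C (μ₁ i)))
    (hchar₂ : (γ₂ • (Mpow γ₂ (-(1/2 : ℝ)) * L * Mpow γ₂ (-(1/2 : ℝ)))).charpoly
      = ∏ i, (X - C (μ₂ i))) :
    μ₁ ⟨0, by omega⟩ = 0 ∧ μ₂ ⟨0, by omega⟩ = 0 ∧
    ∀ i : Fin N, (i : ℕ) ≠ 0 → μ₁ i < μ₂ i := by
  have hNpos : 0 < N := by omega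
  have : Nontrivial (Fin N) := Fin.nontrivial_iff_two_le.mpr hN
  have hdeg : ∀ i, d i = G.degree i := fun i => by
    rw [hd, hA, G.degree_eq_sum_if_adj]
    simp [SimpleGraph.adjMatrix_apply]
  have hdpos : ∀ i, 0 < d i := fun i => by
    rw [hdeg]
    exact_mod_cast hGconn.preconnected.degree_pos_of_nontrivial i
  have hLlap : L = G.lapMatrix ℝ := by
    rw [hL, hD, hA, SimpleGraph.lapMatrix, SimpleGraph.degMatrix, funext hdeg]
  have hLpsd : ∀ x, 0 ≤ x ⬝ᵥ L *ᵥ x := fun x => by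
    simpa [hLlap] using (G.posSemidef_lapMatrix ℝ).dotProduct_mulVec_nonneg x
  have hLone : (1 : Fin N → ℝ) ⬝ᵥ L *ᵥ 1 = 0 := by
    have h := G.lapMatrix_mulVec_const_eq_zero (R := ℝ)
    rw [hLlap, show (1 : Fin N → ℝ) = fun _ => 1 from rfl, h, dotProduct_zero]
  have hLker : ∀ x : Fin N → ℝ, x ⬝ᵥ L *ᵥ x ≤ 0 → ∀ i j, x i = x j := fun x hx i j => by
    have h0 := le_antisymm hx (hLpsd x)
    rw [hLlap, ← toLinearMap₂'_apply',
      G.lapMatrix_toLinearMap₂'_apply'_eq_zero_iff_forall_reachable] at h0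
    exact h0 i j (hGconn.preconnected i j)
  have hLsymm : L.IsSymm := hLlap ▸ G.isSymm_lapMatrix ℝ
  have hγ₂pos := hγ₁.trans hγ₁₂
  have hppos : ∀ γ : ℝ, 0 < γ → γ ≤ 1 → ∀ i, 0 < d i + γ⁻¹ - 1 := fun γ h h' i => by
    linarith [hdpos i, (one_le_inv₀ h).mpr h']
  rw [hMpow, smul_diagonal_rpow_conj L hγ₁.le] at hchar₁
  rw [hMpow, smul_diagonal_rpow_conj L hγ₂pos.le] at hchar₂
  obtain ⟨Y, hY⟩ := exists_simultaneous_diagonalization hLsymm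
    (fun i => sqrt_mul_rpow_sq_mul hγ₁ (hγ₁₂.le.trans hγ₂) (hdpos i)) hμ₁mono hchar₁
  obtain ⟨Z, hZ⟩ := exists_simultaneous_diagonalization hLsymm
    (fun i => sqrt_mul_rpow_sq_mul hγ₂pos hγ₂ (hdpos i)) hμ₂mono hchar₂
  refine ⟨eigenvalue_zero_eq_zero hNpos hLpsd hLone (hppos γ₁ hγ₁ (hγ₁₂.le.trans hγ₂)) hμ₁mono hY,
    eigenvalue_zero_eq_zero hNpos hLpsd hLone (hppos γ₂ hγ₂pos hγ₂) hμ₂mono hZ, fun i hi => ?_⟩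
  refine eigenvalue_lt_of_weight_lt (hppos γ₂ hγ₂pos hγ₂) (fun j => ?_) hμ₁mono hμ₂mono hY hZ
    (eigenvalue_pos hLker hμ₁mono (fun x => (hY x).1) hi)
  gcongr
end

section
/- Let v_i, v_j, v_m be vertices of G such that the spectral distance satisfies d_s(v_m, v_j) < d_s(v_i, v_j), i.e. |φ_m^{(1)} − φ_j^{(1)}| < |φ_i^{(1)} − φ_j^{(1)}|. Then there exists a constant C ∈ ℝ such that for all t ≥ C, the diffusion distance satisfies d_t(v_m, v_j) < d_t(v_i, v_j). -/
open Matrix Real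

open Filter Topology

/-- An exponential sum tends, after rescaling by its slowest decaying exponential, to the
coefficient of that exponential. -/
theorem tendsto_sum_exp_mul_rescaled {ι : Type*} [Fintype ι] [DecidableEq ι] (lam c : ι → ℝ)
    (k₀ : ι) (hlam : ∀ k, k ≠ k₀ → lam k₀ < lam k) :
    Tendsto (fun t : ℝ => ∑ k, Real.exp (-2 * t * (lam k - lam k₀)) * c k) atTop (𝓝 (c k₀)) := by
  have hterm : ∀ k ∈ Finset.univ, Tendsto
      (fun t : ℝ => Real.exp (-2 * t * (lam k - lam k₀)) * c k) atTop
      (𝓝 (if k = k₀ then c k else 0)) := by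
    intro k _
    by_cases hk : k = k₀
    · simp [hk]
    · have hgap : 0 < 2 * (lam k - lam k₀) := by linarith [hlam k hk]
      have hexp : Tendsto (fun t : ℝ => Real.exp (-2 * t * (lam k - lam k₀))) atTop (𝓝 0) := by
        refine (Real.tendsto_exp_neg_atTop_nhds_zero.comp
          (tendsto_id.const_mul_atTop hgap)).congr fun t => ?_
        simp only [Function.comp_apply, id]
        ring_nf
      simpa [hk] using hexp.mul_const (c k)
  simpa using tendsto_finsetSum Finset.univ hterm

/-- An exponential sum whose slowest decaying exponential has a positive coefficient is
eventually positive. -/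
theorem eventually_sum_exp_mul_pos {ι : Type*} [Fintype ι] [DecidableEq ι] (lam c : ι → ℝ)
    (k₀ : ι) (hlam : ∀ k, k ≠ k₀ → lam k₀ < lam k) (hc : 0 < c k₀) :
    ∀ᶠ t : ℝ in atTop, 0 < ∑ k, Real.exp (-2 * t * lam k) * c k := by
  filter_upwards [(tendsto_sum_exp_mul_rescaled lam c k₀ hlam).eventually_const_lt hc] with t ht
  have hfactor : ∑ k, Real.exp (-2 * t * lam k) * c k =
      Real.exp (-2 * t * lam k₀) * ∑ k, Real.exp (-2 * t * (lam k - lam k₀)) * c k := by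
    rw [Finset.mul_sum]
    refine Finset.sum_congr rfl fun k _ => ?_
    rw [← mul_assoc, ← Real.exp_add]
    ring_nf
  rw [hfactor]
  exact mul_pos (Real.exp_pos _) ht

/-- Let `v_i, v_j, v_m` be vertices of `G` such that the spectral distance
satisfies `d_s(v_m, v_j) < d_s(v_i, v_j)`, i.e. `|φ_m^{(1)} − φ_j^{(1)}| < |φ_i^{(1)} − φ_j^{(1)}|`.
Then there is a constant `C` such that for all `t ≥ C` the diffusion distance satisfies
`d_t(v_m, v_j) < d_t(v_i, v_j)`. -/
theorem stmt_13 (N : ℕ) (hN : 2 ≤ N)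
    (G : SimpleGraph (Fin N)) [DecidableRel G.Adj] (hGconn : G.Connected)
    (A : Matrix (Fin N) (Fin N) ℝ) (hA : A = G.adjMatrix ℝ)
    (d : Fin N → ℝ) (hd : ∀ i, d i = ∑ j, A i j)
    (D : Matrix (Fin N) (Fin N) ℝ) (hD : D = Matrix.diagonal d)
    (L : Matrix (Fin N) (Fin N) ℝ) (hL : L = D - A)
    (γ : ℝ) (hγ : γ ∈ Set.Ioc (0 : ℝ) 1)
    (hpos : ∀ i, 0 < γ * d i + (1 - γ))
    (Mpow : ℝ → Matrix (Fin N) (Fin N) ℝ)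
    (hMpow : ∀ β : ℝ, Mpow β = Matrix.diagonal (fun i => (γ * d i + (1 - γ)) ^ β))
    (lam : Fin (N - 1) → ℝ) (hlampos : ∀ k, 0 < lam k)
    (hlam1 : ∀ k : Fin (N - 1), k ≠ ⟨0, by omega⟩ → lam ⟨0, by omega⟩ < lam k)
    (φ : Fin (N - 1) → Fin N → ℝ)
    (heig : ∀ k, (γ • (Mpow (-1) * L)) *ᵥ φ k = lam k • φ k)
    (i j m : Fin N)
    (hspec : |φ ⟨0, by omega⟩ m - φ ⟨0, by omega⟩ j|
      < |φ ⟨0, by omega⟩ i - φ ⟨0, by omega⟩ j|) :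
    ∃ C : ℝ, ∀ t : ℝ, C ≤ t →
      Real.sqrt (∑ k, Real.exp (-2 * t * lam k) * (φ k m - φ k j) ^ 2)
        < Real.sqrt (∑ k, Real.exp (-2 * t * lam k) * (φ k i - φ k j) ^ 2) := by
  have hgap : 0 < (φ ⟨0, by omega⟩ i - φ ⟨0, by omega⟩ j) ^ 2
      - (φ ⟨0, by omega⟩ m - φ ⟨0, by omega⟩ j) ^ 2 := sub_pos.2 (sq_lt_sq.2 hspec)
  obtain ⟨C, hC⟩ := eventually_atTop.1 (eventually_sum_exp_mul_pos lam
    (fun k => (φ k i - φ k j) ^ 2 - (φ k m - φ k j) ^ 2) ⟨0, by omega⟩ hlam1 hgap)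
  refine ⟨C, fun t ht => Real.sqrt_lt_sqrt (by positivity) ?_⟩
  have hpos_sum := hC t ht
  simp only [mul_sub, Finset.sum_sub_distrib] at hpos_sum
  exact sub_pos.1 hpos_sum
end

section
/- Let v_i, v_j be vertices of G with φ_i^{(1)} ≠ φ_j^{(1)}. Then e^{tλ₁} · d_t(v_i, v_j) → |φ_i^{(1)} − φ_j^{(1)}| as t → ∞; that is, the diffusion distance d_t(v_i, v_j) is asymptotically proportional to e^{-tλ₁} with proportionality constant equal to the spectral distance d_s(v_i, v_j). -/
open Matrix Real Filter

/-- After rescaling by `e^{t a₀}`, the square root of a finite sum of squares with weights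
`e^{-2 t a k}` is governed by the term of the strictly smallest rate `a₀`. -/
theorem tendsto_exp_mul_sqrt_sum_exp {ι : Type*} [Fintype ι] (a c : ι → ℝ) (k₀ : ι)
    (ha : ∀ k, k ≠ k₀ → a k₀ < a k) :
    Tendsto
      (fun t : ℝ => Real.exp (t * a k₀) * Real.sqrt (∑ k, Real.exp (-2 * t * a k) * c k ^ 2))
      atTop (nhds |c k₀|) := by
  classical
  have hrw : ∀ t : ℝ,
      Real.exp (t * a k₀) * Real.sqrt (∑ k, Real.exp (-2 * t * a k) * c k ^ 2) =
        Real.sqrt (∑ k, Real.exp (-(2 * (a k - a k₀)) * t) * c k ^ 2) := by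
    intro t
    rw [← Real.sqrt_sq (Real.exp_pos (t * a k₀)).le, ← Real.sqrt_mul (sq_nonneg _),
      Finset.mul_sum]
    congr 1
    refine Finset.sum_congr rfl fun k _ => ?_
    rw [← mul_assoc, ← Real.exp_nat_mul, ← Real.exp_add]
    push_cast
    ring_nf
  have hterm : ∀ k, Tendsto (fun t : ℝ => Real.exp (-(2 * (a k - a k₀)) * t) * c k ^ 2)
      atTop (nhds (if k = k₀ then c k₀ ^ 2 else 0)) := by
    intro k
    split_ifs with h
    · subst h
      simp
    · have hneg : -(2 * (a k - a k₀)) < 0 := by linarith [ha k h]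
      simpa using (Real.tendsto_exp_atBot.comp
        (tendsto_id.const_mul_atTop_of_neg hneg)).mul_const (c k ^ 2)
  have hsum := (tendsto_finsetSum Finset.univ fun k _ => hterm k).sqrt
  rw [Finset.sum_ite_eq' Finset.univ k₀, if_pos (Finset.mem_univ _), Real.sqrt_sq_eq_abs] at hsum
  exact hsum.congr fun t => (hrw t).symm

/-- Let `v_i, v_j` be vertices of `G` with `φ_i^{(1)} ≠ φ_j^{(1)}`. Then
`e^{tλ₁} d_t(v_i, v_j) → |φ_i^{(1)} − φ_j^{(1)}|` as `t → ∞`; that is, the diffusion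
distance is asymptotically proportional to `e^{-tλ₁}` with constant the spectral distance. -/
theorem stmt_14 (N : ℕ) (hN : 2 ≤ N)
    (G : SimpleGraph (Fin N)) [DecidableRel G.Adj] (hGconn : G.Connected)
    (A : Matrix (Fin N) (Fin N) ℝ) (hA : A = G.adjMatrix ℝ)
    (d : Fin N → ℝ) (hd : ∀ i, d i = ∑ j, A i j)
    (D : Matrix (Fin N) (Fin N) ℝ) (hD : D = Matrix.diagonal d)
    (L : Matrix (Fin N) (Fin N) ℝ) (hL : L = D - A)
    (γ : ℝ) (hγ : γ ∈ Set.Ioc (0 : ℝ) 1)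
    (hpos : ∀ i, 0 < γ * d i + (1 - γ))
    (Mpow : ℝ → Matrix (Fin N) (Fin N) ℝ)
    (hMpow : ∀ β : ℝ, Mpow β = Matrix.diagonal (fun i => (γ * d i + (1 - γ)) ^ β))
    (lam : Fin (N - 1) → ℝ) (hlampos : ∀ k, 0 < lam k)
    (hlam1 : ∀ k : Fin (N - 1), k ≠ ⟨0, by omega⟩ → lam ⟨0, by omega⟩ < lam k)
    (φ : Fin (N - 1) → Fin N → ℝ)
    (heig : ∀ k, (γ • (Mpow (-1) * L)) *ᵥ φ k = lam k • φ k)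
    (i j : Fin N)
    (hne : φ ⟨0, by omega⟩ i ≠ φ ⟨0, by omega⟩ j) :
    Tendsto
      (fun t : ℝ => Real.exp (t * lam ⟨0, by omega⟩) *
        Real.sqrt (∑ k, Real.exp (-2 * t * lam k) * (φ k i - φ k j) ^ 2))
      atTop (nhds |φ ⟨0, by omega⟩ i - φ ⟨0, by omega⟩ j|) := by
  exact tendsto_exp_mul_sqrt_sum_exp lam (fun k => φ k i - φ k j) ⟨0, by omega⟩ hlam1
end
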